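/- Let M̄ = M₁ ×_{(f₁,f₂)} M₂ be a base conformal warped product with metric ḡ = f₁²g ⊕ f₂²h, dim M₁ = m, dim M₂ = n. Then its scalar curvature S̄ satisfies f₁² S̄ = S_{M₁} + S_{M₂} f₁²/f₂² − 2(m−1)Δ_{M₁}f₁/f₁ − 2n Δ_{M₁}f₂/f₂ − (m−4)(m−1) g(∇f₁,∇f₁)/f₁² − 2n(m−2) g(∇f₂,∇f₁)/(f₁f₂) − n(n−1) g(∇f₂,∇f₂)/f₂². -/

import Mathlib

noncomputable section

open Matrix

variable {ι : Type*} [Fintype ι] [DecidableEq ι]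

/-- Partial derivative in the `i`-th coordinate direction. -/
def pd (i : ι) (φ : (ι → ℝ) → ℝ) (x : ι → ℝ) : ℝ :=
  fderiv ℝ φ x (Pi.single i 1)

/-- Christoffel symbols `Γ^k_{ij}` of a coordinate metric. -/
def christoffel (g : (ι → ℝ) → Matrix ι ι ℝ) (k i j : ι) (x : ι → ℝ) : ℝ :=
  (1 / 2) * ∑ l, (g x)⁻¹ k l *
    (pd i (fun y => g y l j) x + pd j (fun y => g y l i) x - pd l (fun y => g y i j) x)

/-- Ricci curvature components `R_{ij}` of a coordinate metric. -/
def ricci (g : (ι → ℝ) → Matrix ι ι ℝ) (i j : ι) (x : ι → ℝ) : ℝ :=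
  (∑ k, (pd k (christoffel g k i j) x - pd j (christoffel g k i k) x))
  + ∑ k, ∑ l, (christoffel g k k l x * christoffel g l i j x
      - christoffel g k j l x * christoffel g l i k x)

/-- Scalar curvature of a coordinate metric. -/
def scalarCurv (g : (ι → ℝ) → Matrix ι ι ℝ) (x : ι → ℝ) : ℝ :=
  ∑ i, ∑ j, (g x)⁻¹ i j * ricci g i j x

/-- Hessian `H_φ(∂_i,∂_j)` with respect to the Levi-Civita connection of `g`. -/
def hess (g : (ι → ℝ) → Matrix ι ι ℝ) (φ : (ι → ℝ) → ℝ) (i j : ι) (x : ι → ℝ) : ℝ :=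
  pd i (pd j φ) x - ∑ k, christoffel g k i j x * pd k φ x

/-- Laplace–Beltrami operator of `g`. -/
def laplacian (g : (ι → ℝ) → Matrix ι ι ℝ) (φ : (ι → ℝ) → ℝ) (x : ι → ℝ) : ℝ :=
  ∑ i, ∑ j, (g x)⁻¹ i j * hess g φ i j x

/-- Inner product of gradients `g(∇φ,∇ψ)`. -/
def gradInner (g : (ι → ℝ) → Matrix ι ι ℝ) (φ ψ : (ι → ℝ) → ℝ) (x : ι → ℝ) : ℝ :=
  ∑ i, ∑ j, (g x)⁻¹ i j * pd i φ x * pd j ψ x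

/-- Einstein tensor `G_{ij} = R_{ij} - (1/2) S g_{ij}`. -/
def einstein (g : (ι → ℝ) → Matrix ι ι ℝ) (i j : ι) (x : ι → ℝ) : ℝ :=
  ricci g i j x - (1 / 2) * scalarCurv g x * g x i j

/-- A (pseudo-Riemannian) coordinate metric: symmetric, everywhere invertible and smooth. -/
def IsMetric (g : (ι → ℝ) → Matrix ι ι ℝ) : Prop :=
  (∀ x, (g x).IsSymm) ∧ (∀ x, IsUnit (g x).det) ∧
    ∀ i j, ContDiff ℝ (⊤ : ℕ∞) (fun x => g x i j)

/-- A Riemannian coordinate metric. -/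
def IsRiemannMetric (g : (ι → ℝ) → Matrix ι ι ℝ) : Prop :=
  (∀ x, (g x).PosDef) ∧ ∀ i j, ContDiff ℝ (⊤ : ℕ∞) (fun x => g x i j)

/-- The base conformal warped product metric `ḡ = f₁²g ⊕ f₂²h` on `M₁ × M₂`,
where `f₁, f₂` depend only on the points of the base `M₁`. -/
def bcwpMetric {m n : ℕ} (g : (Fin m → ℝ) → Matrix (Fin m) (Fin m) ℝ)
    (h : (Fin n → ℝ) → Matrix (Fin n) (Fin n) ℝ)
    (f₁ f₂ : (Fin m → ℝ) → ℝ) :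
    ((Fin m ⊕ Fin n) → ℝ) → Matrix (Fin m ⊕ Fin n) (Fin m ⊕ Fin n) ℝ :=
  fun x => Matrix.fromBlocks ((f₁ (x ∘ Sum.inl)) ^ 2 • g (x ∘ Sum.inl)) 0 0
    ((f₂ (x ∘ Sum.inl)) ^ 2 • h (x ∘ Sum.inr))

theorem pd_add {φ ψ : (ι → ℝ) → ℝ} (hφ : Differentiable ℝ φ) (hψ : Differentiable ℝ ψ) (i : ι)
    (x : ι → ℝ) : pd i (fun y => φ y + ψ y) x = pd i φ x + pd i ψ x := by
  simp [pd, fderiv_fun_add (hφ x) (hψ x)]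

theorem pd_sub {φ ψ : (ι → ℝ) → ℝ} (hφ : Differentiable ℝ φ) (hψ : Differentiable ℝ ψ) (i : ι)
    (x : ι → ℝ) : pd i (fun y => φ y - ψ y) x = pd i φ x - pd i ψ x := by
  simp [pd, fderiv_fun_sub (hφ x) (hψ x)]

theorem pd_mul {φ ψ : (ι → ℝ) → ℝ} (hφ : Differentiable ℝ φ) (hψ : Differentiable ℝ ψ) (i : ι)
    (x : ι → ℝ) : pd i (fun y => φ y * ψ y) x = pd i φ x * ψ x + φ x * pd i ψ x := by
  simp [pd, fderiv_fun_mul (hφ x) (hψ x)]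
  ring

theorem pd_const_mul {φ : (ι → ℝ) → ℝ} (hφ : Differentiable ℝ φ) (c : ℝ) (i : ι)
    (x : ι → ℝ) : pd i (fun y => c * φ y) x = c * pd i φ x := by
  simp [pd, fderiv_const_mul (hφ x)]

theorem pd_sum {κ : Type*} [Fintype κ] {φ : κ → (ι → ℝ) → ℝ} (hφ : ∀ k, Differentiable ℝ (φ k))
    (i : ι) (x : ι → ℝ) : pd i (fun y => ∑ k, φ k y) x = ∑ k, pd i (φ k) x := by
  simp [pd, fderiv_fun_sum (fun k _ => hφ k x)]

theorem pd_exp {φ : (ι → ℝ) → ℝ} (hφ : Differentiable ℝ φ) (i : ι) (x : ι → ℝ) :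
    pd i (fun y => Real.exp (φ y)) x = Real.exp (φ x) * pd i φ x := by
  simp [pd, fderiv_exp (hφ x)]

theorem pd_log {φ : (ι → ℝ) → ℝ} (hφ : Differentiable ℝ φ) (h0 : ∀ x, φ x ≠ 0) (i : ι)
    (x : ι → ℝ) : pd i (fun y => Real.log (φ y)) x = (φ x)⁻¹ * pd i φ x := by
  simp [pd, fderiv.log (hφ x) (h0 x)]

theorem pd_inv {φ : (ι → ℝ) → ℝ} (hφ : Differentiable ℝ φ) (h0 : ∀ x, φ x ≠ 0) (i : ι)
    (x : ι → ℝ) : pd i (fun y => (φ y)⁻¹) x = -pd i φ x / (φ x) ^ 2 := by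
  have : HasFDerivAt (fun y => (φ y)⁻¹) ((-((φ x) ^ 2)⁻¹) • fderiv ℝ φ x) x :=
    (hasDerivAt_inv (h0 x)).comp_hasFDerivAt x (hφ x).hasFDerivAt
  simp [pd, this.fderiv]
  ring

theorem contDiff_pd {φ : (ι → ℝ) → ℝ} (hφ : ContDiff ℝ (⊤ : ℕ∞) φ) (i : ι) :
    ContDiff ℝ (⊤ : ℕ∞) (pd i φ) :=
  (hφ.fderiv_right (m := (⊤ : ℕ∞)) (by simp)).clm_apply contDiff_const

theorem pd_comm {φ : (ι → ℝ) → ℝ} (hφ : ContDiff ℝ (⊤ : ℕ∞) φ) (i j : ι) (x : ι → ℝ) :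
    pd i (pd j φ) x = pd j (pd i φ) x := by
  have hd : Differentiable ℝ (fderiv ℝ φ) :=
    (hφ.fderiv_right (m := (⊤ : ℕ∞)) (by simp)).differentiable (by simp)
  have key : ∀ a b : ι, pd a (pd b φ) x
      = fderiv ℝ (fderiv ℝ φ) x (Pi.single a 1) (Pi.single b 1) := by
    intro a b
    have : pd b φ = fun y => fderiv ℝ φ y (Pi.single b 1) := rfl
    rw [pd, this, fderiv_clm_apply (hd x) (by fun_prop)]
    simp
  rw [key, key]
  exact (hφ.contDiffAt.isSymmSndFDerivAt 
    (by simpa using WithTop.coe_le_coe.2 (le_top : (2 : ℕ∞) ≤ ⊤))).eq _ _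

theorem pd_comp_reindex {κ : Type*} [Fintype κ] {φ : (κ → ℝ) → ℝ} (hφ : Differentiable ℝ φ)
    (e : κ → ι) (i : ι) (x : ι → ℝ) :
    pd i (fun y => φ (y ∘ e)) x = fderiv ℝ φ (x ∘ e) (Pi.single i 1 ∘ e) := by
  have hL : HasFDerivAt (fun y : ι → ℝ => y ∘ e)
      (ContinuousLinearMap.pi fun a => ContinuousLinearMap.proj (R := ℝ)
        (φ := fun _ : ι => ℝ) (e a)) x :=
    (ContinuousLinearMap.pi fun a => ContinuousLinearMap.proj (R := ℝ)
        (φ := fun _ : ι => ℝ) (e a)).hasFDerivAt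
  rw [pd, HasFDerivAt.fderiv (f := fun y => φ (y ∘ e)) ((hφ (x ∘ e)).hasFDerivAt.comp x hL)]
  rfl

theorem pd_comp_inl {κ : Type*} [Fintype κ] [DecidableEq κ] {φ : (ι → ℝ) → ℝ}
    (hφ : Differentiable ℝ φ) (i : ι) (x : ι ⊕ κ → ℝ) :
    pd (Sum.inl i) (fun y : ι ⊕ κ → ℝ => φ (y ∘ Sum.inl)) x = pd i φ (x ∘ Sum.inl) := by
  rw [pd_comp_reindex hφ, pd]
  congr 1
  ext a
  simp [Pi.single_apply]

theorem pd_comp_inr {κ : Type*} [Fintype κ] [DecidableEq κ] {φ : (κ → ℝ) → ℝ}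
    (hφ : Differentiable ℝ φ) (i : κ) (x : ι ⊕ κ → ℝ) :
    pd (Sum.inr i) (fun y : ι ⊕ κ → ℝ => φ (y ∘ Sum.inr)) x = pd i φ (x ∘ Sum.inr) := by
  rw [pd_comp_reindex hφ, pd]
  congr 1
  ext a
  simp [Pi.single_apply]

theorem pd_inr_comp_inl {κ : Type*} [Fintype κ] [DecidableEq κ] {φ : (ι → ℝ) → ℝ}
    (hφ : Differentiable ℝ φ) (i : κ) (x : ι ⊕ κ → ℝ) :
    pd (Sum.inr i) (fun y : ι ⊕ κ → ℝ => φ (y ∘ Sum.inl)) x = 0 := by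
  rw [pd_comp_reindex hφ]
  convert map_zero (fderiv ℝ φ (x ∘ Sum.inl))
  ext a
  simp

theorem pd_inl_comp_inr {κ : Type*} [Fintype κ] [DecidableEq κ] {φ : (κ → ℝ) → ℝ}
    (hφ : Differentiable ℝ φ) (i : ι) (x : ι ⊕ κ → ℝ) :
    pd (Sum.inl i) (fun y : ι ⊕ κ → ℝ => φ (y ∘ Sum.inr)) x = 0 := by
  rw [pd_comp_reindex hφ]
  convert map_zero (fderiv ℝ φ (x ∘ Sum.inr))
  ext a
  simp

theorem contDiff_det {E : Type*} [NormedAddCommGroup E] [NormedSpace ℝ E]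
    {A : E → Matrix ι ι ℝ} {n : WithTop ℕ∞} (hA : ∀ i j, ContDiff ℝ n fun x => A x i j) :
    ContDiff ℝ n fun x => (A x).det := by
  simp only [Matrix.det_apply]
  exact ContDiff.sum fun σ _ => (contDiff_prod fun i _ => hA _ _).const_smul _

theorem IsMetric.contDiff_inv {g : (ι → ℝ) → Matrix ι ι ℝ} (hg : IsMetric g) (i j : ι) :
    ContDiff ℝ (⊤ : ℕ∞) fun x => (g x)⁻¹ i j := by
  simp only [Matrix.inv_def, Matrix.smul_apply, Ring.inverse_eq_inv', smul_eq_mul,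
    Matrix.adjugate_apply]
  refine ((contDiff_det hg.2.2).inv fun x => (hg.2.1 x).ne_zero).mul (contDiff_det fun a b => ?_)
  simp only [Matrix.updateRow_apply]
  split_ifs
  · exact contDiff_const
  · exact hg.2.2 a b

theorem IsMetric.contDiff_christoffel {g : (ι → ℝ) → Matrix ι ι ℝ} (hg : IsMetric g) (k i j : ι) :
    ContDiff ℝ (⊤ : ℕ∞) (christoffel g k i j) :=
  contDiff_const.mul <| ContDiff.sum fun l _ => (hg.contDiff_inv k l).mul <|
    ((contDiff_pd (hg.2.2 _ _) _).add (contDiff_pd (hg.2.2 _ _) _)).sub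
      (contDiff_pd (hg.2.2 _ _) _)

theorem ContDiff.differentiable_top {E F : Type*} [NormedAddCommGroup E] [NormedSpace ℝ E]
    [NormedAddCommGroup F] [NormedSpace ℝ F] {φ : E → F} (hφ : ContDiff ℝ (⊤ : ℕ∞) φ) :
    Differentiable ℝ φ :=
  hφ.differentiable (by simp)

theorem IsMetric.sum_mul_inv {g : (ι → ℝ) → Matrix ι ι ℝ} (hg : IsMetric g) (x : ι → ℝ) (i j : ι) :
    ∑ k, g x i k * (g x)⁻¹ k j = if i = j then 1 else 0 := by
  rw [← Matrix.mul_apply, Matrix.mul_nonsing_inv _ (hg.2.1 x), Matrix.one_apply]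

theorem IsMetric.sum_inv_mul {g : (ι → ℝ) → Matrix ι ι ℝ} (hg : IsMetric g) (x : ι → ℝ) (i j : ι) :
    ∑ k, (g x)⁻¹ i k * g x k j = if i = j then 1 else 0 := by
  rw [← Matrix.mul_apply, Matrix.nonsing_inv_mul _ (hg.2.1 x), Matrix.one_apply]

theorem IsMetric.inv_comm {g : (ι → ℝ) → Matrix ι ι ℝ} (hg : IsMetric g) (x : ι → ℝ) (i j : ι) :
    (g x)⁻¹ i j = (g x)⁻¹ j i := by
  have := (hg.1 x).inv
  exact this.apply j i

theorem IsMetric.comm {g : (ι → ℝ) → Matrix ι ι ℝ} (hg : IsMetric g) (x : ι → ℝ) (i j : ι) :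
    g x i j = g x j i :=
  (hg.1 x).apply j i

theorem IsMetric.christoffel_comm {g : (ι → ℝ) → Matrix ι ι ℝ} (hg : IsMetric g) (k i j : ι)
    (x : ι → ℝ) : christoffel g k i j x = christoffel g k j i x := by
  have : (fun y => g y i j) = fun y => g y j i := funext fun y => hg.comm y i j
  simp only [christoffel, this]
  congr 1
  refine Finset.sum_congr rfl fun l _ => ?_
  ring

/-- The Christoffel symbols with the upper index lowered. -/
theorem IsMetric.sum_mul_christoffel {g : (ι → ℝ) → Matrix ι ι ℝ} (hg : IsMetric g) (l i j : ι)
    (x : ι → ℝ) : ∑ k, g x l k * christoffel g k i j x = (1 / 2) *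
      (pd i (fun y => g y l j) x + pd j (fun y => g y l i) x - pd l (fun y => g y i j) x) := by
  simp only [christoffel, Finset.mul_sum]
  rw [Finset.sum_comm]
  have : ∀ a : ι, ∑ k, g x l k * (1 / 2 * ((g x)⁻¹ k a * (pd i (fun y => g y a j) x +
      pd j (fun y => g y a i) x - pd a (fun y => g y i j) x))) =
      (∑ k, g x l k * (g x)⁻¹ k a) * (1 / 2 * (pd i (fun y => g y a j) x +
      pd j (fun y => g y a i) x - pd a (fun y => g y i j) x)) := by
    intro a
    rw [Finset.sum_mul]
    exact Finset.sum_congr rfl fun k _ => by ring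
  rw [Finset.sum_congr rfl fun a _ => this a]
  simp [hg.sum_mul_inv]

/-- Metric compatibility of the Levi-Civita connection. -/
theorem IsMetric.pd_metric {g : (ι → ℝ) → Matrix ι ι ℝ} (hg : IsMetric g) (k i j : ι)
    (x : ι → ℝ) : pd k (fun y => g y i j) x =
      ∑ l, (g x i l * christoffel g l j k x + g x j l * christoffel g l i k x) := by
  rw [Finset.sum_add_distrib, hg.sum_mul_christoffel, hg.sum_mul_christoffel]
  have : (fun y => g y i j) = fun y => g y j i := funext fun y => hg.comm y i j
  rw [this]
  have : (fun y => g y i k) = fun y => g y k i := funext fun y => hg.comm y i k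
  rw [this]
  have : (fun y => g y j k) = fun y => g y k j := funext fun y => hg.comm y j k
  rw [this]
  ring

/-- The components of the gradient of `φ` with respect to `g`. -/
def grad (g : (ι → ℝ) → Matrix ι ι ℝ) (φ : (ι → ℝ) → ℝ) (k : ι) (x : ι → ℝ) : ℝ :=
  ∑ l, (g x)⁻¹ k l * pd l φ x

theorem IsMetric.contDiff_grad {g : (ι → ℝ) → Matrix ι ι ℝ} (hg : IsMetric g)
    {φ : (ι → ℝ) → ℝ} (hφ : ContDiff ℝ (⊤ : ℕ∞) φ) (k : ι) :
    ContDiff ℝ (⊤ : ℕ∞) (grad g φ k) :=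
  ContDiff.sum fun l _ => (hg.contDiff_inv k l).mul (contDiff_pd hφ l)

theorem IsMetric.sum_mul_sum_inv {g : (ι → ℝ) → Matrix ι ι ℝ} (hg : IsMetric g) (x : ι → ℝ)
    (w : ι → ℝ) (i : ι) : ∑ k, g x i k * ∑ l, (g x)⁻¹ k l * w l = w i := by
  have h := congrFun (Matrix.mulVec_mulVec w (g x) (g x)⁻¹) i
  rw [Matrix.mul_nonsing_inv _ (hg.2.1 x), Matrix.one_mulVec] at h
  exact h

theorem IsMetric.sum_inv_mul_sum {g : (ι → ℝ) → Matrix ι ι ℝ} (hg : IsMetric g) (x : ι → ℝ)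
    (w : ι → ℝ) (i : ι) : ∑ k, (g x)⁻¹ i k * ∑ l, g x k l * w l = w i := by
  have h := congrFun (Matrix.mulVec_mulVec w (g x)⁻¹ (g x)) i
  rw [Matrix.nonsing_inv_mul _ (hg.2.1 x), Matrix.one_mulVec] at h
  exact h

theorem IsMetric.sum_mul_grad {g : (ι → ℝ) → Matrix ι ι ℝ} (hg : IsMetric g)
    (φ : (ι → ℝ) → ℝ) (i : ι) (x : ι → ℝ) : ∑ k, g x i k * grad g φ k x = pd i φ x :=
  hg.sum_mul_sum_inv x _ i

theorem gradInner_eq_sum (g : (ι → ℝ) → Matrix ι ι ℝ) (φ ψ : (ι → ℝ) → ℝ) (x : ι → ℝ) :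
    gradInner g φ ψ x = ∑ i, pd i φ x * grad g ψ i x := by
  simp only [gradInner, grad, Finset.mul_sum]
  exact Finset.sum_congr rfl fun i _ => Finset.sum_congr rfl fun j _ => by ring

/-- The Hessian of `φ` is the covariant derivative of its gradient, with an index lowered. -/
theorem IsMetric.hess_eq {g : (ι → ℝ) → Matrix ι ι ℝ} (hg : IsMetric g)
    {φ : (ι → ℝ) → ℝ} (hφ : ContDiff ℝ (⊤ : ℕ∞) φ) (i j : ι) (x : ι → ℝ) :
    hess g φ i j x = ∑ a, g x j a *
      (pd i (grad g φ a) x + ∑ k, christoffel g a i k x * grad g φ k x) := by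
  have hV := fun k => (hg.contDiff_grad hφ k).differentiable_top
  have hG := fun k => (hg.2.2 j k).differentiable_top
  have h1 : pd i (pd j φ) x = ∑ k, (pd i (fun y => g y j k) x * grad g φ k x
      + g x j k * pd i (grad g φ k) x) := by
    rw [← funext (hg.sum_mul_grad φ j),
      pd_sum (φ := fun k y => g y j k * grad g φ k y) fun k => (hG k).mul (hV k)]
    exact Finset.sum_congr rfl fun k _ => pd_mul (hG k) (hV k) i x
  have h2 : ∑ a, christoffel g a i j x * pd a φ x
      = ∑ k, (∑ a, g x k a * christoffel g a j i x) * grad g φ k x := by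
    simp only [← hg.sum_mul_grad φ _ x, Finset.mul_sum, Finset.sum_mul]
    rw [Finset.sum_comm]
    refine Finset.sum_congr rfl fun k _ => Finset.sum_congr rfl fun a _ => ?_
    rw [hg.comm x a k, hg.christoffel_comm a i j]
    ring
  have h3 : ∑ a, g x j a * ∑ k, christoffel g a i k x * grad g φ k x
      = ∑ k, (∑ a, g x j a * christoffel g a k i x) * grad g φ k x := by
    simp only [Finset.mul_sum, Finset.sum_mul]
    rw [Finset.sum_comm]
    refine Finset.sum_congr rfl fun k _ => Finset.sum_congr rfl fun a _ => ?_
    rw [hg.christoffel_comm a i k]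
    ring
  simp only [mul_add, Finset.sum_add_distrib]
  rw [hess, h1, h2, h3]
  simp only [hg.pd_metric, Finset.sum_add_distrib, add_mul]
  ring

/-- The Laplacian is the divergence of the gradient. -/
theorem IsMetric.laplacian_eq {g : (ι → ℝ) → Matrix ι ι ℝ} (hg : IsMetric g)
    {φ : (ι → ℝ) → ℝ} (hφ : ContDiff ℝ (⊤ : ℕ∞) φ) (x : ι → ℝ) :
    laplacian g φ x = ∑ a, pd a (grad g φ a) x
      + ∑ a, ∑ k, christoffel g a a k x * grad g φ k x := by
  simp only [laplacian, hg.hess_eq hφ]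
  rw [← Finset.sum_add_distrib]
  refine Finset.sum_congr rfl fun i _ => ?_
  exact hg.sum_inv_mul_sum x
    (fun a => pd i (grad g φ a) x + ∑ k, christoffel g a i k x * grad g φ k x) i

/-- The conformally rescaled metric `exp (2 u) g`. -/
def conformal (u : (ι → ℝ) → ℝ) (g : (ι → ℝ) → Matrix ι ι ℝ) : (ι → ℝ) → Matrix ι ι ℝ :=
  fun x => Real.exp (2 * u x) • g x

theorem conformal_inv {g : (ι → ℝ) → Matrix ι ι ℝ} (hg : IsMetric g) (u : (ι → ℝ) → ℝ)
    (x : ι → ℝ) : (conformal u g x)⁻¹ = Real.exp (-(2 * u x)) • (g x)⁻¹ := by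
  refine Matrix.inv_eq_left_inv ?_
  rw [conformal, smul_mul_smul_comm, Matrix.nonsing_inv_mul _ (hg.2.1 x), ← Real.exp_add]
  simp

theorem IsMetric.conformal {g : (ι → ℝ) → Matrix ι ι ℝ} (hg : IsMetric g) {u : (ι → ℝ) → ℝ}
    (hu : ContDiff ℝ (⊤ : ℕ∞) u) : IsMetric (conformal u g) := by
  refine ⟨fun x => (hg.1 x).smul _, fun x => ?_, fun i j => ?_⟩
  · rw [_root_.conformal, Matrix.det_smul]
    exact ((Real.exp_ne_zero _).isUnit.pow _).mul (hg.2.1 x)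
  · exact (contDiff_const.mul hu).exp.mul (hg.2.2 i j)

/-- The difference of the Christoffel symbols of `conformal u g` and `g`. -/
def conformalDiff (u : (ι → ℝ) → ℝ) (g : (ι → ℝ) → Matrix ι ι ℝ) (k i j : ι) (x : ι → ℝ) : ℝ :=
  (if k = i then 1 else 0) * pd j u x + (if k = j then 1 else 0) * pd i u x
    - g x i j * grad g u k x

theorem christoffel_conformal {g : (ι → ℝ) → Matrix ι ι ℝ} (hg : IsMetric g)
    {u : (ι → ℝ) → ℝ} (hu : ContDiff ℝ (⊤ : ℕ∞) u) (k i j : ι) (x : ι → ℝ) :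
    christoffel (conformal u g) k i j x = christoffel g k i j x + conformalDiff u g k i j x := by
  have hpd : ∀ a b c : ι, pd a (fun y => conformal u g y b c) x = Real.exp (2 * u x) *
      (2 * pd a u x * g x b c + pd a (fun y => g y b c) x) := by
    intro a b c
    have h2u : Differentiable ℝ fun y => 2 * u y := hu.differentiable_top.const_mul 2
    change pd a (fun y => Real.exp (2 * u y) * g y b c) x = _
    rw [pd_mul h2u.exp (hg.2.2 b c).differentiable_top, pd_exp h2u,
      pd_const_mul hu.differentiable_top]
    ring
  have he : Real.exp (-(2 * u x)) * Real.exp (2 * u x) = 1 := by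
    rw [← Real.exp_add]; simp
  simp only [christoffel, conformalDiff, hpd, conformal_inv hg, Matrix.smul_apply, smul_eq_mul, grad,
    ← hg.sum_inv_mul x, Finset.mul_sum, Finset.sum_mul, ← Finset.sum_add_distrib,
    ← Finset.sum_sub_distrib]
  refine Finset.sum_congr rfl fun l _ => ?_
  linear_combination ((g x)⁻¹ k l * (1 / 2 * (pd i (fun y => g y l j) x
    + pd j (fun y => g y l i) x - pd l (fun y => g y i j) x) + g x l i * pd j u x
    + g x l j * pd i u x - g x i j * pd l u x)) * he

section ConformalAlgebra

variable {G : ι → ι → ℝ} {U V : ι → ℝ} {C : ι → ι → ι → ℝ}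

theorem sum_conformal_mul
    (hC : ∀ k i j, C k i j = (if k = i then 1 else 0) * U j + (if k = j then 1 else 0) * U i
      - G i j * V k) (j : ι) (X : ι → ι → ℝ) :
    ∑ k, ∑ l, C k j l * X l k = ∑ l, U l * X l j + U j * ∑ k, X k k
      - ∑ k, ∑ l, G j l * V k * X l k := by
  simp [hC, sub_mul, add_mul, Finset.sum_add_distrib, Finset.mul_sum]

theorem trace_conformal
    (hC : ∀ k i j, C k i j = (if k = i then 1 else 0) * U j + (if k = j then 1 else 0) * U i
      - G i j * V k) (hV : ∀ i, ∑ k, G i k * V k = U i) (i : ι) :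
    ∑ k, C k i k = Fintype.card ι * U i := by
  simp [hC, Finset.sum_add_distrib, hV]

theorem trace_conformal'
    (hC : ∀ k i j, C k i j = (if k = i then 1 else 0) * U j + (if k = j then 1 else 0) * U i
      - G i j * V k) (hG : ∀ i j, G i j = G j i) (hV : ∀ i, ∑ k, G i k * V k = U i) (i : ι) :
    ∑ k, C k k i = Fintype.card ι * U i := by
  rw [← trace_conformal hC hV i]
  refine Finset.sum_congr rfl fun k _ => ?_
  rw [hC, hC, hG]
  ring

/-- The quadratic part of the Ricci tensor under a conformal change of the connection. -/
theorem ricci_quadratic_conformal {Γ : ι → ι → ι → ℝ}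
    (hC : ∀ k i j, C k i j = (if k = i then 1 else 0) * U j + (if k = j then 1 else 0) * U i
      - G i j * V k) (hG : ∀ i j, G i j = G j i) (hV : ∀ i, ∑ k, G i k * V k = U i)
    (hΓ : ∀ k i j, Γ k i j = Γ k j i) (i j : ι) :
    ∑ k, ∑ l, ((Γ k k l + C k k l) * (Γ l i j + C l i j)
        - (Γ k j l + C k j l) * (Γ l i k + C l i k)) =
      ∑ k, ∑ l, (Γ k k l * Γ l i j - Γ k j l * Γ l i k)
      + ((Fintype.card ι : ℝ) - 2) * ∑ l, U l * Γ l i j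
      - G i j * ∑ k, ∑ l, Γ k k l * V l
      + ∑ k, (∑ l, (G i l * Γ l j k + G j l * Γ l i k)) * V k
      + ((Fintype.card ι : ℝ) - 2) * (U i * U j - G i j * ∑ k, U k * V k) := by
  have hUC : ∀ i j, ∑ l, U l * C l i j = 2 * (U i * U j) - G i j * ∑ k, U k * V k := by
    intro i j
    simp only [hC, mul_add, mul_sub, Finset.sum_add_distrib, Finset.sum_sub_distrib]
    simp [Finset.mul_sum, mul_left_comm]
    ring
  have hGVC : ∑ k, ∑ l, G j l * V k * C l i k = G i j * ∑ k, U k * V k := by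
    have h1 : ∑ k, ∑ l, G j l * V k * (G i k * V l) = U j * U i := by
      rw [← hV j, ← hV i, Finset.sum_mul_sum, Finset.sum_comm]
      exact Finset.sum_congr rfl fun k _ => Finset.sum_congr rfl fun l _ => by ring
    have h2 : ∑ k, G j k * V k * U i = U j * U i := by rw [← Finset.sum_mul, hV]
    simp only [hC, mul_add, mul_sub, Finset.sum_add_distrib, Finset.sum_sub_distrib, h1]
    simp [h2, Finset.mul_sum, hG i j]
    exact Finset.sum_congr rfl fun k _ => by ring
  have hGVΓ : ∀ i j, ∑ k, ∑ l, G j l * V k * Γ l i k = ∑ k, (∑ l, G j l * Γ l i k) * V k := by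
    intro i j
    simp only [Finset.sum_mul]
    exact Finset.sum_congr rfl fun k _ => Finset.sum_congr rfl fun l _ => by ring
  have hCΓ := sum_conformal_mul hC j fun l k => Γ l i k
  have hΓC := sum_conformal_mul hC i fun l k => Γ l j k
  have hCC := sum_conformal_mul hC j fun l k => C l i k
  have hΓC' : ∑ k, ∑ l, Γ k j l * C l i k = ∑ k, ∑ l, C k i l * Γ l j k := by
    rw [Finset.sum_comm]
    exact Finset.sum_congr rfl fun k _ => Finset.sum_congr rfl fun l _ => by ring
  have htr : ∑ k, ∑ l, Γ k k l * C l i j = (∑ k, Γ k i k) * U j + (∑ k, Γ k j k) * U i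
      - G i j * ∑ k, ∑ l, Γ k k l * V l := by
    simp only [hC, mul_add, mul_sub, Finset.sum_add_distrib, Finset.sum_sub_distrib]
    simp [Finset.mul_sum, Finset.sum_mul, hΓ _ i, hΓ _ j, mul_left_comm]
  have hCtr : ∀ X : ι → ℝ, ∑ k, ∑ l, C k k l * X l = Fintype.card ι * ∑ l, U l * X l := by
    intro X
    rw [Finset.sum_comm, Finset.mul_sum]
    refine Finset.sum_congr rfl fun l _ => ?_
    rw [← Finset.sum_mul, trace_conformal' hC hG hV]
    ring
  have hsymm : ∑ l, U l * Γ l j i = ∑ l, U l * Γ l i j :=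
    Finset.sum_congr rfl fun l _ => by rw [hΓ]
  rw [hGVΓ] at hCΓ hΓC
  rw [hGVC, hUC, trace_conformal hC hV] at hCC
  simp only [add_mul, mul_add, Finset.sum_add_distrib, Finset.sum_sub_distrib, htr, hCtr, hUC,
    hCΓ, hΓC', hΓC, hCC, hsymm]
  ring

end ConformalAlgebra

theorem ricci_conformal {g : (ι → ℝ) → Matrix ι ι ℝ} (hg : IsMetric g)
    {u : (ι → ℝ) → ℝ} (hu : ContDiff ℝ (⊤ : ℕ∞) u) (i j : ι) (x : ι → ℝ) :
    ricci (conformal u g) i j x = ricci g i j x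
      - ((Fintype.card ι : ℝ) - 2) * (hess g u i j x - pd i u x * pd j u x)
      - (laplacian g u x + ((Fintype.card ι : ℝ) - 2) * gradInner g u u x) * g x i j := by
  have hΓ := fun k i j => (hg.contDiff_christoffel k i j).differentiable_top
  have hU := fun k => (contDiff_pd hu k).differentiable_top
  have hV := fun k => (hg.contDiff_grad hu k).differentiable_top
  have hG := fun i j => (hg.2.2 i j).differentiable_top
  have hcU : ∀ (c : ℝ) (k : ι), Differentiable ℝ fun y => c * pd k u y := fun c k =>
    (hU k).const_mul c
  have hUU : ∀ (a b : ℝ) (i j : ι), Differentiable ℝ fun y => a * pd j u y + b * pd i u y :=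
    fun a b i j => (hcU a j).add (hcU b i)
  have hGV : ∀ i j k, Differentiable ℝ fun y => g y i j * grad g u k y := fun i j k =>
    (hG i j).mul (hV k)
  have hC : ∀ k i j, Differentiable ℝ (conformalDiff u g k i j) := fun k i j =>
    (hUU _ _ i j).sub (hGV i j k)
  have h1 : ∀ k a b c, pd c (christoffel (conformal u g) k a b) x =
      pd c (christoffel g k a b) x + pd c (conformalDiff u g k a b) x := by
    intro k a b c
    rw [funext (christoffel_conformal hg hu k a b), pd_add (hΓ k a b) (hC k a b)]
  have h2 : ∑ k, pd k (conformalDiff u g k i j) x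
      = 2 * pd i (pd j u) x - ∑ k, pd k (fun y => g y i j) x * grad g u k x
        - g x i j * ∑ k, pd k (grad g u k) x := by
    have : ∀ k, pd k (conformalDiff u g k i j) x =
        (if k = i then 1 else 0) * pd k (pd j u) x + (if k = j then 1 else 0) * pd k (pd i u) x
        - (pd k (fun y => g y i j) x * grad g u k x + g x i j * pd k (grad g u k) x) := by
      intro k
      rw [← pd_mul (hG i j) (hV k), ← pd_const_mul (hU j), ← pd_const_mul (hU i),
        ← pd_add (hcU _ j) (hcU _ i), ← pd_sub (hUU _ _ i j) (hGV i j k)]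
      rfl
    simp only [this, Finset.sum_add_distrib, Finset.sum_sub_distrib, ← Finset.mul_sum]
    simp [pd_comm hu j i]
    ring
  have h3 : ∑ k, pd j (conformalDiff u g k i k) x = Fintype.card ι * pd i (pd j u) x := by
    rw [← pd_sum fun k => hC k i k, pd_comm hu i j, ← pd_const_mul (hU i)]
    congr 1
    funext y
    exact trace_conformal (C := fun k i j => conformalDiff u g k i j y) (G := g y)
      (U := fun i => pd i u y) (V := fun k => grad g u k y) (fun _ _ _ => rfl)
      (fun i => hg.sum_mul_grad u i y) i
  have h4 := ricci_quadratic_conformal (G := g x) (U := fun i => pd i u x)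
    (V := fun k => grad g u k x) (Γ := fun k i j => christoffel g k i j x)
    (C := fun k i j => conformalDiff u g k i j x) (fun _ _ _ => rfl) (hg.comm x)
    (fun i => hg.sum_mul_grad u i x) (fun k i j => hg.christoffel_comm k i j x) i j
  simp only [← hg.pd_metric] at h4
  have h5 : ∑ l, pd l u x * christoffel g l i j x = ∑ k, christoffel g k i j x * pd k u x :=
    Finset.sum_congr rfl fun l _ => mul_comm _ _
  simp only [ricci, christoffel_conformal hg hu _ _ _ x, h4]
  simp only [h1, Finset.sum_sub_distrib, Finset.sum_add_distrib, h2, h3]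
  rw [hess, hg.laplacian_eq hu, gradInner_eq_sum, h5]
  ring

theorem IsMetric.sum_inv_mul_self {g : (ι → ℝ) → Matrix ι ι ℝ} (hg : IsMetric g) (x : ι → ℝ) :
    ∑ i, ∑ j, (g x)⁻¹ i j * g x i j = Fintype.card ι := by
  have h : ∀ i, ∑ j, (g x)⁻¹ i j * g x i j = 1 := fun i => by
    rw [Finset.sum_congr rfl fun j _ => by rw [hg.comm x i j], hg.sum_inv_mul, if_pos rfl]
  simp [h]

/-- Scalar curvature under a conformal change of the metric. -/
theorem scalarCurv_conformal {g : (ι → ℝ) → Matrix ι ι ℝ} (hg : IsMetric g)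
    {u : (ι → ℝ) → ℝ} (hu : ContDiff ℝ (⊤ : ℕ∞) u) (x : ι → ℝ) :
    scalarCurv (conformal u g) x = Real.exp (-(2 * u x)) * (scalarCurv g x
      - 2 * ((Fintype.card ι : ℝ) - 1) * laplacian g u x
      - ((Fintype.card ι : ℝ) - 2) * ((Fintype.card ι : ℝ) - 1) * gradInner g u u x) := by
  have h : ∀ i j, (conformal u g x)⁻¹ i j * ricci (conformal u g) i j x =
      Real.exp (-(2 * u x)) * ((g x)⁻¹ i j * ricci g i j x
        - ((Fintype.card ι : ℝ) - 2) * ((g x)⁻¹ i j * hess g u i j x)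
        + ((Fintype.card ι : ℝ) - 2) * ((g x)⁻¹ i j * pd i u x * pd j u x)
        - (laplacian g u x + ((Fintype.card ι : ℝ) - 2) * gradInner g u u x)
          * ((g x)⁻¹ i j * g x i j)) := by
    intro i j
    rw [ricci_conformal hg hu, conformal_inv hg, Matrix.smul_apply, smul_eq_mul]
    ring
  simp only [scalarCurv, h, ← Finset.mul_sum, Finset.sum_add_distrib, Finset.sum_sub_distrib,
    hg.sum_inv_mul_self]
  rw [← laplacian, ← gradInner]
  ring

theorem IsMetric.gradInner_comm {g : (ι → ℝ) → Matrix ι ι ℝ} (hg : IsMetric g)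
    (φ ψ : (ι → ℝ) → ℝ) (x : ι → ℝ) : gradInner g φ ψ x = gradInner g ψ φ x := by
  rw [gradInner, Finset.sum_comm]
  refine Finset.sum_congr rfl fun i _ => Finset.sum_congr rfl fun j _ => ?_
  rw [hg.inv_comm x j i]
  ring

theorem gradInner_conformal {g : (ι → ℝ) → Matrix ι ι ℝ} (hg : IsMetric g)
    (u φ ψ : (ι → ℝ) → ℝ) (x : ι → ℝ) :
    gradInner (conformal u g) φ ψ x = Real.exp (-(2 * u x)) * gradInner g φ ψ x := by
  simp only [gradInner, conformal_inv hg, Matrix.smul_apply, smul_eq_mul, Finset.mul_sum,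
    mul_assoc]

theorem laplacian_conformal {g : (ι → ℝ) → Matrix ι ι ℝ} (hg : IsMetric g)
    {u : (ι → ℝ) → ℝ} (hu : ContDiff ℝ (⊤ : ℕ∞) u) (φ : (ι → ℝ) → ℝ) (x : ι → ℝ) :
    laplacian (conformal u g) φ x = Real.exp (-(2 * u x)) * (laplacian g φ x
      + ((Fintype.card ι : ℝ) - 2) * gradInner g φ u x) := by
  have h : ∀ i j, (conformal u g x)⁻¹ i j * hess (conformal u g) φ i j x =
      Real.exp (-(2 * u x)) * ((g x)⁻¹ i j * hess g φ i j x
        - (g x)⁻¹ i j * pd i φ x * pd j u x - (g x)⁻¹ i j * pd i u x * pd j φ x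
        + gradInner g φ u x * ((g x)⁻¹ i j * g x i j)) := by
    intro i j
    have : hess (conformal u g) φ i j x = hess g φ i j x - pd i φ x * pd j u x
        - pd i u x * pd j φ x + gradInner g φ u x * g x i j := by
      rw [gradInner_eq_sum]
      simp only [hess, christoffel_conformal hg hu, conformalDiff, add_mul, sub_mul,
        Finset.sum_add_distrib, Finset.sum_sub_distrib, Finset.sum_mul]
      simp [mul_comm, mul_left_comm]
      ring
    rw [this, conformal_inv hg, Matrix.smul_apply, smul_eq_mul]
    ring
  simp only [laplacian, h, ← Finset.mul_sum, Finset.sum_add_distrib, Finset.sum_sub_distrib,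
    hg.sum_inv_mul_self]
  rw [← gradInner, ← gradInner, hg.gradInner_comm u φ]
  ring

section Product

variable {κ : Type*} [Fintype κ] [DecidableEq κ]

/-- The product metric `g ⊕ h`. -/
def prodMetric (g : (ι → ℝ) → Matrix ι ι ℝ) (h : (κ → ℝ) → Matrix κ κ ℝ) :
    (ι ⊕ κ → ℝ) → Matrix (ι ⊕ κ) (ι ⊕ κ) ℝ :=
  fun x => Matrix.fromBlocks (g (x ∘ Sum.inl)) 0 0 (h (x ∘ Sum.inr))

variable {g : (ι → ℝ) → Matrix ι ι ℝ} {h : (κ → ℝ) → Matrix κ κ ℝ}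

theorem prodMetric_inv (hg : IsMetric g) (hh : IsMetric h) (x : ι ⊕ κ → ℝ) :
    (prodMetric g h x)⁻¹ =
      Matrix.fromBlocks (g (x ∘ Sum.inl))⁻¹ 0 0 (h (x ∘ Sum.inr))⁻¹ := by
  refine Matrix.inv_eq_left_inv ?_
  simp [prodMetric, Matrix.fromBlocks_multiply, Matrix.nonsing_inv_mul _ (hg.2.1 _),
    Matrix.nonsing_inv_mul _ (hh.2.1 _)]

theorem contDiff_comp_reindex {α β : Type*} [Fintype α] [Fintype β] {φ : (α → ℝ) → ℝ}
    (hφ : ContDiff ℝ (⊤ : ℕ∞) φ) (e : α → β) :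
    ContDiff ℝ (⊤ : ℕ∞) fun x : β → ℝ => φ (x ∘ e) :=
  hφ.comp (contDiff_pi.2 fun a => contDiff_apply ℝ ℝ (e a))

theorem IsMetric.prodMetric (hg : IsMetric g) (hh : IsMetric h) :
    IsMetric (prodMetric g h) := by
  refine ⟨fun x => ?_, fun x => ?_, fun i j => ?_⟩
  · exact Matrix.IsSymm.fromBlocks (hg.1 _) (by simp) (hh.1 _)
  · rw [_root_.prodMetric, Matrix.det_fromBlocks_zero₂₁]
    exact (hg.2.1 _).mul (hh.2.1 _)
  · rcases i with i | i <;> rcases j with j | j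
    · exact contDiff_comp_reindex (hg.2.2 i j) Sum.inl
    · exact contDiff_const
    · exact contDiff_const
    · exact contDiff_comp_reindex (hh.2.2 i j) Sum.inr

theorem pd_zero {α : Type*} [DecidableEq α] (i : α) (x : α → ℝ) :
    pd i (fun _ => 0) x = 0 := by
  simp [pd]

theorem christoffel_prodMetric (hg : IsMetric g) (hh : IsMetric h) (k i j : ι ⊕ κ)
    (x : ι ⊕ κ → ℝ) : christoffel (prodMetric g h) k i j x =
      match k, i, j with
      | Sum.inl k, Sum.inl i, Sum.inl j => christoffel g k i j (x ∘ Sum.inl)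
      | Sum.inr k, Sum.inr i, Sum.inr j => christoffel h k i j (x ∘ Sum.inr)
      | _, _, _ => 0 := by
  have hG := fun i j => (hg.2.2 i j).differentiable_top
  have hH := fun i j => (hh.2.2 i j).differentiable_top
  have h1 := fun (i j c : ι) => pd_comp_inl (κ := κ) (hG i j) c x
  have h2 := fun (i j : ι) (c : κ) => pd_inr_comp_inl (hG i j) c x
  have h3 := fun (i j : κ) (c : ι) => pd_inl_comp_inr (hH i j) c x
  have h4 := fun (i j c : κ) => pd_comp_inr (ι := ι) (hH i j) c x
  simp only [christoffel, prodMetric_inv hg hh, Fintype.sum_sum_type]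
  rcases k with k | k <;> rcases i with i | i <;> rcases j with j | j <;>
    simp [prodMetric, h1, h2, h3, h4, pd_zero]

theorem ricci_prodMetric (hg : IsMetric g) (hh : IsMetric h) (i j : ι ⊕ κ) (x : ι ⊕ κ → ℝ) :
    ricci (prodMetric g h) i j x =
      match i, j with
      | Sum.inl i, Sum.inl j => ricci g i j (x ∘ Sum.inl)
      | Sum.inr i, Sum.inr j => ricci h i j (x ∘ Sum.inr)
      | _, _ => 0 := by
  have hG := fun k i j => (hg.contDiff_christoffel k i j).differentiable_top
  have hH := fun k i j => (hh.contDiff_christoffel k i j).differentiable_top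
  have h1 := fun (k i j c : ι) => pd_comp_inl (κ := κ) (hG k i j) c x
  have h2 := fun (k i j : ι) (c : κ) => pd_inr_comp_inl (hG k i j) c x
  have h3 := fun (k i j : κ) (c : ι) => pd_inl_comp_inr (hH k i j) c x
  have h4 := fun (k i j c : κ) => pd_comp_inr (ι := ι) (hH k i j) c x
  have hΓ := fun k i j => funext (christoffel_prodMetric hg hh k i j)
  rcases i with i | i <;> rcases j with j | j <;>
    simp [ricci, hΓ, h1, h2, h3, h4, pd_zero]

theorem scalarCurv_prodMetric (hg : IsMetric g) (hh : IsMetric h) (x : ι ⊕ κ → ℝ) :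
    scalarCurv (prodMetric g h) x
      = scalarCurv g (x ∘ Sum.inl) + scalarCurv h (x ∘ Sum.inr) := by
  simp [scalarCurv, prodMetric_inv hg hh, ricci_prodMetric hg hh]

theorem gradInner_prodMetric (hg : IsMetric g) (hh : IsMetric h) {φ ψ : (ι → ℝ) → ℝ}
    (hφ : Differentiable ℝ φ) (hψ : Differentiable ℝ ψ) (x : ι ⊕ κ → ℝ) :
    gradInner (prodMetric g h) (fun y => φ (y ∘ Sum.inl)) (fun y => ψ (y ∘ Sum.inl)) x
      = gradInner g φ ψ (x ∘ Sum.inl) := by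
  simp [gradInner, prodMetric_inv hg hh, pd_comp_inl hφ, pd_comp_inl hψ, pd_inr_comp_inl hφ,
    pd_inr_comp_inl hψ]

theorem laplacian_prodMetric (hg : IsMetric g) (hh : IsMetric h) {φ : (ι → ℝ) → ℝ}
    (hφ : ContDiff ℝ (⊤ : ℕ∞) φ) (x : ι ⊕ κ → ℝ) :
    laplacian (prodMetric g h) (fun y => φ (y ∘ Sum.inl)) x = laplacian g φ (x ∘ Sum.inl) := by
  have hφ' := hφ.differentiable_top
  have h1 := fun i => funext (pd_comp_inl (κ := κ) hφ' i)
  have h2 := fun i : κ => funext (pd_inr_comp_inl hφ' i)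
  have h3 := fun i => pd_comp_inl (κ := κ) (contDiff_pd hφ i).differentiable_top
  simp [laplacian, hess, prodMetric_inv hg hh, christoffel_prodMetric hg hh, h1, h2, h3, pd_zero]

end Product

theorem gradInner_log {g : (ι → ℝ) → Matrix ι ι ℝ} {φ ψ : (ι → ℝ) → ℝ}
    (hφ : Differentiable ℝ φ) (hψ : Differentiable ℝ ψ) (hφ0 : ∀ x, φ x ≠ 0)
    (hψ0 : ∀ x, ψ x ≠ 0) (x : ι → ℝ) :
    gradInner g (fun y => Real.log (φ y)) (fun y => Real.log (ψ y)) x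
      = gradInner g φ ψ x / (φ x * ψ x) := by
  simp only [gradInner, pd_log hφ hφ0, pd_log hψ hψ0, Finset.sum_div]
  refine Finset.sum_congr rfl fun i _ => Finset.sum_congr rfl fun j _ => ?_
  field_simp [hφ0 x, hψ0 x]

theorem laplacian_log {g : (ι → ℝ) → Matrix ι ι ℝ} {φ : (ι → ℝ) → ℝ}
    (hφ : ContDiff ℝ (⊤ : ℕ∞) φ) (hφ0 : ∀ x, φ x ≠ 0) (x : ι → ℝ) :
    laplacian g (fun y => Real.log (φ y)) x
      = laplacian g φ x / φ x - gradInner g φ φ x / (φ x) ^ 2 := by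
  have hφ' := hφ.differentiable_top
  have hinv : Differentiable ℝ fun y => (φ y)⁻¹ := hφ'.inv hφ0
  have hh : ∀ i j, hess g (fun y => Real.log (φ y)) i j x
      = hess g φ i j x / φ x - pd i φ x * pd j φ x / (φ x) ^ 2 := by
    intro i j
    rw [hess, hess, funext (pd_log hφ' hφ0 j),
      pd_mul hinv (contDiff_pd hφ j).differentiable_top, pd_inv hφ' hφ0, sub_div, Finset.sum_div]
    have : ∑ k, christoffel g k i j x * pd k (fun y => Real.log (φ y)) x
        = ∑ k, christoffel g k i j x * pd k φ x / φ x :=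
      Finset.sum_congr rfl fun k _ => by rw [pd_log hφ' hφ0]; ring
    rw [this]
    ring
  simp only [laplacian, gradInner, hh, Finset.sum_div, ← Finset.sum_sub_distrib]
  exact Finset.sum_congr rfl fun i _ => Finset.sum_congr rfl fun j _ => by ring

theorem laplacian_sub (g : (ι → ℝ) → Matrix ι ι ℝ) {φ ψ : (ι → ℝ) → ℝ}
    (hφ : ContDiff ℝ (⊤ : ℕ∞) φ) (hψ : ContDiff ℝ (⊤ : ℕ∞) ψ) (x : ι → ℝ) :
    laplacian g (fun y => φ y - ψ y) x = laplacian g φ x - laplacian g ψ x := by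
  have h := fun i => funext (pd_sub hφ.differentiable_top hψ.differentiable_top i)
  have h' := fun i j => pd_sub (contDiff_pd hφ j).differentiable_top
    (contDiff_pd hψ j).differentiable_top i x
  simp only [laplacian, hess, h, h', mul_sub, Finset.sum_sub_distrib]
  ring

theorem gradInner_sub_right (g : (ι → ℝ) → Matrix ι ι ℝ) (φ : (ι → ℝ) → ℝ) {ψ χ : (ι → ℝ) → ℝ}
    (hψ : Differentiable ℝ ψ) (hχ : Differentiable ℝ χ) (x : ι → ℝ) :
    gradInner g φ (fun y => ψ y - χ y) x = gradInner g φ ψ x - gradInner g φ χ x := by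
  simp only [gradInner, pd_sub hψ hχ, mul_sub, Finset.sum_sub_distrib]

/-- scalar curvature of a base conformal warped product. -/
theorem bcwp_scalar_curv {m n : ℕ}
    (g : (Fin m → ℝ) → Matrix (Fin m) (Fin m) ℝ)
    (h : (Fin n → ℝ) → Matrix (Fin n) (Fin n) ℝ)
    (f₁ f₂ : (Fin m → ℝ) → ℝ)
    (hg : IsMetric g) (hh : IsMetric h)
    (hf₁ : ContDiff ℝ (⊤ : ℕ∞) f₁) (hf₂ : ContDiff ℝ (⊤ : ℕ∞) f₂)
    (hf₁pos : ∀ u, 0 < f₁ u) (hf₂pos : ∀ u, 0 < f₂ u) :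
    ∀ x : (Fin m ⊕ Fin n) → ℝ,
      (f₁ (x ∘ Sum.inl)) ^ 2 * scalarCurv (bcwpMetric g h f₁ f₂) x
        = scalarCurv g (x ∘ Sum.inl)
          + scalarCurv h (x ∘ Sum.inr) * (f₁ (x ∘ Sum.inl)) ^ 2 / (f₂ (x ∘ Sum.inl)) ^ 2
          - 2 * ((m : ℝ) - 1) * laplacian g f₁ (x ∘ Sum.inl) / f₁ (x ∘ Sum.inl)
          - 2 * (n : ℝ) * laplacian g f₂ (x ∘ Sum.inl) / f₂ (x ∘ Sum.inl)
          - ((m : ℝ) - 4) * ((m : ℝ) - 1) * gradInner g f₁ f₁ (x ∘ Sum.inl)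
              / (f₁ (x ∘ Sum.inl)) ^ 2
          - 2 * (n : ℝ) * ((m : ℝ) - 2) * gradInner g f₂ f₁ (x ∘ Sum.inl)
              / (f₁ (x ∘ Sum.inl) * f₂ (x ∘ Sum.inl))
          - (n : ℝ) * ((n : ℝ) - 1) * gradInner g f₂ f₂ (x ∘ Sum.inl)
              / (f₂ (x ∘ Sum.inl)) ^ 2 := by
  intro x
  set p := x ∘ Sum.inl with hp
  have hf₁0 : ∀ u, f₁ u ≠ 0 := fun u => (hf₁pos u).ne'
  have hf₂0 : ∀ u, f₂ u ≠ 0 := fun u => (hf₂pos u).ne'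
  have hd₁ := hf₁.differentiable_top
  have hd₂ := hf₂.differentiable_top
  have hl₁ : ContDiff ℝ (⊤ : ℕ∞) fun u => Real.log (f₁ u) := hf₁.log hf₁0
  have hl₂ : ContDiff ℝ (⊤ : ℕ∞) fun u => Real.log (f₂ u) := hf₂.log hf₂0
  have hw : ContDiff ℝ (⊤ : ℕ∞) fun u => Real.log (f₁ u) - Real.log (f₂ u) := hl₁.sub hl₂
  have hgw := hg.conformal hw
  have he : ∀ {f : (Fin m → ℝ) → ℝ}, (∀ u, 0 < f u) → ∀ u,
      Real.exp (2 * Real.log (f u)) = f u ^ 2 :=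
    fun {f} hf u => by rw [two_mul, Real.exp_add, Real.exp_log (hf u), sq]
  have hmetric : bcwpMetric g h f₁ f₂ = conformal (fun y => Real.log (f₂ (y ∘ Sum.inl)))
      (prodMetric (conformal (fun u => Real.log (f₁ u) - Real.log (f₂ u)) g) h) := by
    funext y
    have h1 := hf₂0 (y ∘ Sum.inl)
    simp only [bcwpMetric, conformal, prodMetric, Matrix.fromBlocks_smul, smul_zero, smul_smul,
      mul_sub, Real.exp_sub, he hf₁pos, he hf₂pos]
    rw [mul_div_cancel₀ _ (pow_ne_zero 2 h1)]
  rw [hmetric, scalarCurv_conformal (hgw.prodMetric hh) (contDiff_comp_reindex hl₂ Sum.inl),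
    scalarCurv_prodMetric hgw hh, laplacian_prodMetric hgw hh hl₂,
    gradInner_prodMetric hgw hh hl₂.differentiable_top hl₂.differentiable_top,
    scalarCurv_conformal hg hw, laplacian_conformal hg hw, gradInner_conformal hg,
    laplacian_sub g hl₁ hl₂, gradInner_sub_right g _ hl₁.differentiable_top hl₂.differentiable_top,
    gradInner_sub_right g _ hl₁.differentiable_top hl₂.differentiable_top,
    hg.gradInner_comm (fun u => Real.log (f₁ u) - Real.log (f₂ u)),
    hg.gradInner_comm (fun u => Real.log (f₁ u) - Real.log (f₂ u)),
    gradInner_sub_right g _ hl₁.differentiable_top hl₂.differentiable_top,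
    gradInner_sub_right g _ hl₁.differentiable_top hl₂.differentiable_top,
    hg.gradInner_comm (fun u => Real.log (f₁ u)) (fun u => Real.log (f₂ u)),
    gradInner_log hd₁ hd₁ hf₁0 hf₁0, gradInner_log hd₂ hd₁ hf₂0 hf₁0,
    gradInner_log hd₂ hd₂ hf₂0 hf₂0, laplacian_log hf₁ hf₁0, laplacian_log hf₂ hf₂0]
  simp only [← hp, Fintype.card_sum, Fintype.card_fin, Real.exp_neg, mul_sub, Real.exp_sub,
    he hf₁pos, he hf₂pos]
  have h1 := hf₁0 p
  have h2 := hf₂0 p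
  push_cast
  field_simp
  ring
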